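/- Fix positive reals A, T, E, S, P with A·E/(A+T+E) > P. With X = T + E·S/(S+E) and α_c = (X + E·P/(S+E)) / (A + X), one has α_c·A < A·(T+E)/(A+T+E); that is, the task completion delay of the local-edge-cloud boundary solution is strictly smaller than the optimal local-edge (no cloud) task completion delay. -/

import Mathlib

/-- Under `A*E/(A+T+E) > P`, the common delay `αc*A` of the local-edge-cloud boundary
solution is strictly smaller than the optimal local-edge (no cloud) delay
`A*(T+E)/(A+T+E)`. -/
theorem stmt_7 (A T E S P : ℝ) (hA : 0 < A) (hT : 0 < T) (hE : 0 < E)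
    (hS : 0 < S) (hP : 0 < P) (hcond : A * E / (A + T + E) > P) :
    let X := T + E * S / (S + E)
    let αc := (X + E * P / (S + E)) / (A + X)
    αc * A < A * (T + E) / (A + T + E) := by
  intro X αc
  have hcond' : P * (A + T + E) < A * E := (lt_div_iff₀ (by positivity)).mp hcond
  have hα : αc * A
      = A * (T * (S + E) + E * S + E * P) / (A * (S + E) + T * (S + E) + E * S) := by
    simp only [αc, X]
    field_simp
    ring
  rw [hα, div_lt_div_iff₀ (by positivity) (by positivity), ← sub_pos]
  have hpos : 0 < A * (E * (A * E - P * (A + T + E))) :=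
    mul_pos hA (mul_pos hE (sub_pos.mpr hcond'))
  linarith
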